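/- arXiv:1908.10280 — 2 statements merged into one kernel-verified Lean document; each statement's English description precedes it below -/
import Mathlib

section
/- Let μ ∈ ℂ with μ ≠ 0. Then there exists a Floquet solution of the delay system with multiplier μ if and only if there exists a differentiable function q = (q_1, …, q_N) : [0,1] → (ℂ^d)^N with q(0) ≠ 0 such that q'(s) = A(s, μ) q(s) for all s ∈ [0,1] and q(1) = B(μ) q(0). (Lemma 2.1 of the paper: characterization of Floquet multipliers by a finite-dimensional two-point boundary value problem.) -/
open scoped BigOperators

noncomputable section

/-- `aExp N k = ⌊(k-1)/N⌋` (floor division). -/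
def aExp (N : ℕ) (k : ℤ) : ℤ := Int.fdiv (k - 1) (N : ℤ)

/-- `bIdx N hN k` is the `Fin N` index (zero-based) corresponding to the
paper index `b_k = ((k-1) mod N) + 1 ∈ {1,…,N}`. -/
def bIdx (N : ℕ) (hN : 0 < N) (k : ℤ) : Fin N :=
  ⟨((k - 1) % (N : ℤ)).toNat, by
    have hN' : (0:ℤ) < (N:ℤ) := by exact_mod_cast hN
    have h1 : 0 ≤ (k - 1) % (N : ℤ) := Int.emod_nonneg _ (ne_of_gt hN')
    have h2 : (k - 1) % (N : ℤ) < (N : ℤ) := Int.emod_lt_of_pos _ hN'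
    omega⟩

/-- The block linear map `A(s,μ)` acting on `(ℂ^d)^N`:
`(A(s,μ)q)_n = Δ Σ_j A_j((s+n-1)Δ) μ^{a_{n-n_j}} q_{b_{n-n_j}}` (paper indices `n = 1,…,N`). -/
def Aop (d h N : ℕ) (hN : 0 < N) (Δ : ℝ)
    (A : Fin (h+1) → ℝ → Matrix (Fin d) (Fin d) ℝ) (nn : Fin (h+1) → ℕ)
    (s : ℝ) (μ : ℂ) (q : Fin N → Fin d → ℂ) : Fin N → Fin d → ℂ :=
  fun n i => (Δ : ℂ) * ∑ j : Fin (h+1),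
    μ ^ aExp N (((n : ℕ) : ℤ) + 1 - (nn j : ℤ)) *
      ∑ i' : Fin d, ((A j ((s + ((n : ℕ) : ℝ)) * Δ)) i i' : ℂ) *
        q (bIdx N hN (((n : ℕ) : ℤ) + 1 - (nn j : ℤ))) i'

/-- The linear map `B(μ)` on `(ℂ^d)^N`:
`(B(μ)q)_n = q_{n+1}` for `n = 1,…,N-1` and `(B(μ)q)_N = μ q_1`. -/
def Bop (d N : ℕ) (hN : 0 < N) (μ : ℂ) (q : Fin N → Fin d → ℂ) : Fin N → Fin d → ℂ :=
  fun n i => if hn : (n : ℕ) + 1 < N then q ⟨(n : ℕ) + 1, hn⟩ i else μ * q ⟨0, hN⟩ i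
/-- A Floquet solution of `x'(t) = Σ_j A_j(t) x(t - n_j Δ)` with multiplier `μ`:
a not-identically-zero differentiable `x : ℝ → ℂ^d` satisfying the delay equation
everywhere together with `x(t+T) = μ x(t)`. -/
def IsFloquetSolution (d h : ℕ) (A : Fin (h+1) → ℝ → Matrix (Fin d) (Fin d) ℝ)
    (nn : Fin (h+1) → ℕ) (Δ T : ℝ) (μ : ℂ) (x : ℝ → Fin d → ℂ) : Prop :=
  (∃ t, x t ≠ 0) ∧
  (∀ t : ℝ, HasDerivAt x (fun i => ∑ j : Fin (h+1), ∑ i' : Fin d,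
      ((A j t) i i' : ℂ) * x (t - (nn j : ℝ) * Δ) i') t) ∧
  (∀ t : ℝ, x (t + T) = fun i => μ * x t i)

/-- Floor division by `N` shifts by `a` when the numerator is increased by `a * N`. -/
theorem aExp_add_mul (N : ℕ) (hN : 0 < N) (k a : ℤ) :
    aExp N (k + a * N) = a + aExp N k := by
  have hN' : (N : ℤ) ≠ 0 := by exact_mod_cast hN.ne'
  unfold aExp
  rw [Int.fdiv_eq_ediv_of_nonneg _ (by positivity), Int.fdiv_eq_ediv_of_nonneg _ (by positivity),
    show k + a * N - 1 = (k - 1) + a * N by ring, Int.add_mul_ediv_right _ _ hN', add_comm]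

theorem bIdx_add_mul (N : ℕ) (hN : 0 < N) (k a : ℤ) :
    bIdx N hN (k + a * N) = bIdx N hN k := by
  unfold bIdx
  simp only [Fin.mk.injEq]
  rw [show k + a * N - 1 = (k - 1) + a * N by ring, Int.add_mul_emod_self_right]

theorem aExp_fin (N : ℕ) (n : Fin N) : aExp N (((n : ℕ) : ℤ) + 1) = 0 := by
  unfold aExp
  rw [Int.fdiv_eq_ediv_of_nonneg _ (by positivity), add_sub_cancel_right]
  exact Int.ediv_eq_zero_of_lt (by positivity) (by exact_mod_cast n.2)

theorem bIdx_fin (N : ℕ) (hN : 0 < N) (n : Fin N) : bIdx N hN (((n : ℕ) : ℤ) + 1) = n := by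
  apply Fin.ext
  unfold bIdx
  simp only [add_sub_cancel_right]
  rw [Int.emod_eq_of_lt (by positivity) (by exact_mod_cast n.2)]
  simp

/-- Division with remainder, with the remainder in `Fin N`. -/
theorem exists_fin_add_mul (N : ℕ) (hN : 0 < N) (m : ℤ) :
    ∃ (n : Fin N) (a : ℤ), m = ((n : ℕ) : ℤ) + a * N := by
  have hN' : (0 : ℤ) < N := by exact_mod_cast hN
  have h1 := Int.emod_nonneg m hN'.ne'
  have h2 := Int.emod_lt_of_pos m hN'
  refine ⟨⟨(m % N).toNat, by omega⟩, m / N, ?_⟩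
  simp only [Int.toNat_of_nonneg h1]
  linarith [Int.emod_add_mul_ediv m N, mul_comm (N : ℤ) (m / N)]

/-- A coefficient of period `p` is unchanged by translation by integer multiples of `p`. -/
theorem periodic_add_int_mul {α : Type*} {f : ℝ → α} {p : ℝ} (hf : ∀ t, f (t + p) = f t)
    (a : ℤ) (t : ℝ) : f (t + a * p) = f t :=
  (show Function.Periodic f p from hf).int_mul a t

theorem multiplier_add_int_mul {d : ℕ} {x : ℝ → Fin d → ℂ} {T : ℝ} {μ : ℂ} (hμ : μ ≠ 0)
    (hx : ∀ t, x (t + T) = fun i => μ * x t i) (a : ℤ) (t : ℝ) (i : Fin d) :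
    x (t + a * T) i = μ ^ a * x t i := by
  induction a using Int.induction_on with
  | zero => simp
  | succ k ih =>
    rw [show t + ((k + 1 : ℤ) : ℝ) * T = (t + ((k : ℤ) : ℝ) * T) + T by push_cast; ring, hx,
      zpow_add_one₀ hμ, mul_right_comm, ← ih]
    exact mul_comm _ _
  | pred k ih =>
    have h := congrFun (hx (t + ((-k - 1 : ℤ) : ℝ) * T)) i
    rw [show t + ((-k - 1 : ℤ) : ℝ) * T + T = t + ((-k : ℤ) : ℝ) * T by push_cast; ring, ih] at h
    rw [zpow_sub_one₀ hμ, mul_right_comm, h]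
    field_simp

/-- The values of a Floquet solution on the `m`-th interval of length `Δ`, in terms of those on
the intervals with index in `Fin N`. -/
theorem multiplier_interval {d N : ℕ} (hN : 0 < N) {Δ : ℝ} {x : ℝ → Fin d → ℂ} {μ : ℂ}
    (hμ : μ ≠ 0) (hx : ∀ t, x (t + N * Δ) = fun i => μ * x t i) (m : ℤ) (s : ℝ) (i : Fin d) :
    x ((s + m) * Δ) i =
      μ ^ aExp N (m + 1) * x ((s + ((bIdx N hN (m + 1) : Fin N) : ℕ)) * Δ) i := by
  obtain ⟨n, a, rfl⟩ := exists_fin_add_mul N hN m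
  rw [add_right_comm, aExp_add_mul N hN, bIdx_add_mul, aExp_fin, bIdx_fin, add_zero,
    ← multiplier_add_int_mul hμ hx]
  congr 2
  push_cast
  ring

/-- The delay equation turns into the block system `q' = A(s,μ) q` for the restrictions of the
solution to consecutive intervals of length `Δ`. -/
theorem hasDerivAt_blocks {d h N : ℕ} (hN : 0 < N) {Δ : ℝ}
    {A : Fin (h+1) → ℝ → Matrix (Fin d) (Fin d) ℝ} {nn : Fin (h+1) → ℕ} {μ : ℂ} (hμ : μ ≠ 0)
    {x : ℝ → Fin d → ℂ} (hx : IsFloquetSolution d h A nn Δ ((N : ℝ) * Δ) μ x) (s : ℝ) :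
    HasDerivAt (fun s (n : Fin N) => x ((s + (n : ℕ)) * Δ))
      (Aop d h N hN Δ A nn s μ (fun n => x ((s + (n : ℕ)) * Δ))) s := by
  obtain ⟨-, hder, hmul⟩ := hx
  rw [hasDerivAt_pi]
  intro n
  have h1 : HasDerivAt (fun s : ℝ => (s + (n : ℕ)) * Δ) Δ s := by
    simpa using ((hasDerivAt_id s).add_const ((n : ℕ) : ℝ)).mul_const Δ
  refine ((hder ((s + (n : ℕ)) * Δ)).scomp s h1).congr_deriv ?_
  ext i
  simp only [Aop, Pi.smul_apply, Complex.real_smul]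
  congr 1
  refine Finset.sum_congr rfl fun j _ => ?_
  rw [Finset.mul_sum]
  refine Finset.sum_congr rfl fun i' _ => ?_
  have := multiplier_interval hN hμ hmul (((n : ℕ) : ℤ) - nn j) s i'
  rw [show (s + (n : ℕ)) * Δ - nn j * Δ = (s + (((n : ℕ) : ℤ) - (nn j : ℤ) : ℤ)) * Δ by
    push_cast; ring, this, show ((n : ℕ) : ℤ) - nn j + 1 = (n : ℕ) + 1 - nn j by ring]
  ring

/-- `A(s,μ)` as a linear map. -/
def AopLin (d h N : ℕ) (hN : 0 < N) (Δ : ℝ)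
    (A : Fin (h+1) → ℝ → Matrix (Fin d) (Fin d) ℝ) (nn : Fin (h+1) → ℕ) (s : ℝ) (μ : ℂ) :
    (Fin N → Fin d → ℂ) →ₗ[ℂ] (Fin N → Fin d → ℂ) where
  toFun := Aop d h N hN Δ A nn s μ
  map_add' p q := by
    ext n i
    simp only [Aop, Pi.add_apply, mul_add, Finset.sum_add_distrib]
  map_smul' c q := by
    ext n i
    simp only [Aop, Pi.smul_apply, smul_eq_mul, RingHom.id_apply, Finset.mul_sum]
    refine Finset.sum_congr rfl fun j _ => Finset.sum_congr rfl fun i' _ => ?_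
    ring

theorem continuous_AopLin {d h N : ℕ} (hN : 0 < N) {Δ : ℝ}
    {A : Fin (h+1) → ℝ → Matrix (Fin d) (Fin d) ℝ} (hA : ∀ j, Continuous (A j))
    (nn : Fin (h+1) → ℕ) (μ : ℂ) :
    Continuous fun s => LinearMap.toContinuousLinearMap (AopLin d h N hN Δ A nn s μ) := by
  rw [continuous_clm_apply]
  intro q
  change Continuous fun s => Aop d h N hN Δ A nn s μ q
  unfold Aop
  fun_prop

/-- A solution on `ℝ` of a linear equation with continuous coefficients vanishes identically
if it vanishes at one point. -/
theorem eq_zero_of_linear_ode {E : Type*} [NormedAddCommGroup E] [NormedSpace ℂ E]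
    {L : ℝ → E →L[ℂ] E} (hL : Continuous L) {q : ℝ → E}
    (hq : ∀ s, HasDerivAt q (L s (q s)) s) (h0 : q 0 = 0) (t : ℝ) : q t = 0 := by
  obtain ⟨K, hK⟩ := (isCompact_Icc (a := -(|t| + 1)) (b := |t| + 1)).exists_bound_of_continuousOn
    hL.continuousOn
  have ht := abs_nonneg t
  refine ODE_solution_unique_of_mem_Ioo (v := fun s y => L s y) (s := fun _ => Set.univ)
    (K := K.toNNReal) (f := q) (g := fun _ => 0) (a := -(|t| + 1)) (b := |t| + 1) (t₀ := 0)
    (fun s hs => ?_) ⟨by linarith, by linarith⟩ (fun s _ => ⟨hq s, trivial⟩)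
    (fun s _ => ⟨by simpa using hasDerivAt_const s (0 : E), trivial⟩) h0
    ⟨by linarith [neg_abs_le t], by linarith [le_abs_self t]⟩
  refine ((L s).lipschitz.weaken ?_).lipschitzOnWith
  rw [← NNReal.coe_le_coe, coe_nnnorm]
  exact (hK s (Set.Ioo_subset_Icc_self hs)).trans (Real.le_coe_toNNReal K)

/-- The extension by the multiplier relation of the blocks `q` to all integer indices. -/
def blockExt {d N : ℕ} (hN : 0 < N) (μ : ℂ) (q : Fin N → Fin d → ℂ) (m : ℤ) : Fin d → ℂ :=
  fun i => μ ^ aExp N (m + 1) * q (bIdx N hN (m + 1)) i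

theorem blockExt_fin_add_mul {d N : ℕ} (hN : 0 < N) (μ : ℂ) (q : Fin N → Fin d → ℂ)
    (n : Fin N) (a : ℤ) (i : Fin d) :
    blockExt hN μ q ((n : ℕ) + a * N) i = μ ^ a * q n i := by
  rw [blockExt, add_right_comm, aExp_add_mul N hN, bIdx_add_mul, aExp_fin, bIdx_fin, add_zero]

theorem blockExt_fin {d N : ℕ} (hN : 0 < N) (μ : ℂ) (q : Fin N → Fin d → ℂ) (n : Fin N) :
    blockExt hN μ q (n : ℕ) = q n := by
  ext i
  simpa using blockExt_fin_add_mul hN μ q n 0 i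

theorem blockExt_add_mul {d N : ℕ} (hN : 0 < N) {μ : ℂ} (hμ : μ ≠ 0) (q : Fin N → Fin d → ℂ)
    (m a : ℤ) (i : Fin d) :
    blockExt hN μ q (m + a * N) i = μ ^ a * blockExt hN μ q m i := by
  rw [blockExt, add_right_comm, aExp_add_mul N hN, bIdx_add_mul, zpow_add₀ hμ, mul_assoc]
  rfl

theorem blockExt_Bop {d N : ℕ} (hN : 0 < N) {μ : ℂ} (hμ : μ ≠ 0) (q : Fin N → Fin d → ℂ)
    (m : ℤ) : blockExt hN μ (Bop d N hN μ q) m = blockExt hN μ q (m + 1) := by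
  ext i
  obtain ⟨n, a, rfl⟩ := exists_fin_add_mul N hN m
  rw [blockExt_fin_add_mul, Bop]
  split_ifs with hn
  · have := blockExt_fin_add_mul hN μ q ⟨n + 1, hn⟩ a i
    rw [← this]
    congr 1
    push_cast
    ring
  · have := blockExt_fin_add_mul hN μ q ⟨0, hN⟩ (a + 1) i
    rw [zpow_add_one₀ hμ, mul_assoc] at this
    rw [← this]
    congr 1
    have : ((n : ℕ) : ℤ) + 1 = N := by have := n.2; omega
    push_cast
    linarith

theorem hasDerivAt_blockExt {d h N : ℕ} (hN : 0 < N) {Δ : ℝ}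
    {A : Fin (h+1) → ℝ → Matrix (Fin d) (Fin d) ℝ}
    (hper : ∀ j t, A j (t + (N : ℝ) * Δ) = A j t) {nn : Fin (h+1) → ℕ} {μ : ℂ} (hμ : μ ≠ 0)
    {q : ℝ → Fin N → Fin d → ℂ} {s : ℝ}
    (hq : HasDerivAt q (Aop d h N hN Δ A nn s μ (q s)) s) (m : ℤ) :
    HasDerivAt (fun s => blockExt hN μ (q s) m) (fun i => (Δ : ℂ) * ∑ j : Fin (h+1),
      ∑ i' : Fin d, ((A j ((s + m) * Δ)) i i' : ℂ) * blockExt hN μ (q s) (m - nn j) i') s := by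
  rw [hasDerivAt_pi]
  intro i
  obtain ⟨n, a, rfl⟩ := exists_fin_add_mul N hN m
  simp only [blockExt_fin_add_mul]
  refine ((hasDerivAt_pi.1 (hasDerivAt_pi.1 hq n) i).const_mul (μ ^ a)).congr_deriv ?_
  simp only [Aop]
  rw [ mul_left_comm, Finset.mul_sum _ _ (μ ^ a)]
  congr 1
  refine Finset.sum_congr rfl fun j _ => ?_
  rw [Finset.mul_sum, Finset.mul_sum]
  refine Finset.sum_congr rfl fun i' _ => ?_
  rw [show ((n : ℕ) : ℤ) + a * N - nn j = (n : ℕ) - nn j + a * N by ring, blockExt_add_mul hN hμ,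
    show (s + (((n : ℕ) : ℤ) + a * N : ℤ)) * Δ = (s + (n : ℕ)) * Δ + a * (N * Δ) by
      push_cast; ring, periodic_add_int_mul (hper j), blockExt,
    show ((n : ℕ) : ℤ) - nn j + 1 = (n : ℕ) + 1 - nn j by ring]
  ring

/-- Concatenation of functions `P m` on `[0,1]` to a function on `ℝ`. -/
def concat {E : Type*} (P : ℤ → ℝ → E) (u : ℝ) : E := P ⌊u⌋ (u - ⌊u⌋)

theorem concat_eq {E : Type*} {P : ℤ → ℝ → E} (hP : ∀ m, P m 1 = P (m + 1) 0) {u : ℝ} {m : ℤ}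
    (h0 : (m : ℝ) ≤ u) (h1 : u ≤ m + 1) : concat P u = P m (u - m) := by
  rcases h1.lt_or_eq with h1 | rfl
  · rw [concat, Int.floor_eq_iff.2 ⟨h0, h1⟩]
  · have : ⌊(m : ℝ) + 1⌋ = m + 1 := by simp
    rw [concat, this, show (m : ℝ) + 1 - m = 1 by ring, hP]
    simp

theorem hasDerivAt_concat {E : Type*} [NormedAddCommGroup E] [NormedSpace ℝ E]
    {P : ℤ → ℝ → E} (hP : ∀ m, P m 1 = P (m + 1) 0) {u : ℝ} {v : E}
    (hv : ∀ m : ℤ, (m : ℝ) ≤ u → u ≤ m + 1 → HasDerivAt (P m) v (u - m)) :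
    HasDerivAt (concat P) v u := by
  have key (m : ℤ) (h0 : (m : ℝ) ≤ u) (h1 : u ≤ m + 1) :
      HasDerivWithinAt (concat P) v (Set.Icc (m : ℝ) (m + 1)) u :=
    ((hv m h0 h1).comp_sub_const u (m : ℝ)).hasDerivWithinAt.congr
      (fun w hw => concat_eq hP hw.1 hw.2) (concat_eq hP h0 h1)
  have hr : HasDerivWithinAt (concat P) v (Set.Ici u) u :=
    (key ⌊u⌋ (Int.floor_le u) (Int.lt_floor_add_one u).le).mono_of_mem_nhdsWithin <|
      Filter.mem_of_superset (Icc_mem_nhdsGE (Int.lt_floor_add_one u))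
        (Set.Icc_subset_Icc_left (Int.floor_le u))
  have hc : ((⌈u⌉ - 1 : ℤ) : ℝ) < u := by push_cast; linarith [Int.ceil_lt_add_one u]
  have hc' : u ≤ ((⌈u⌉ - 1 : ℤ) : ℝ) + 1 := by push_cast; linarith [Int.le_ceil u]
  have hl : HasDerivWithinAt (concat P) v (Set.Iic u) u :=
    (key (⌈u⌉ - 1) hc.le hc').mono_of_mem_nhdsWithin <|
      Filter.mem_of_superset (Icc_mem_nhdsLE hc) (Set.Icc_subset_Icc_right hc')
  have := hl.union hr
  rwa [Set.Iic_union_Ici, hasDerivWithinAt_univ] at this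

/-- A solution of the boundary value problem with `q 0 ≠ 0` extends to a Floquet solution. -/
theorem isFloquetSolution_concat {d h N : ℕ} (hN : 0 < N) {Δ : ℝ} (hΔ : 0 < Δ)
    {A : Fin (h+1) → ℝ → Matrix (Fin d) (Fin d) ℝ}
    (hper : ∀ j t, A j (t + (N : ℝ) * Δ) = A j t) {nn : Fin (h+1) → ℕ} {μ : ℂ} (hμ : μ ≠ 0)
    {q : ℝ → Fin N → Fin d → ℂ} (hq0 : q 0 ≠ 0)
    (hq : ∀ s ∈ Set.Icc (0:ℝ) 1, HasDerivAt q (Aop d h N hN Δ A nn s μ (q s)) s)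
    (hq1 : q 1 = Bop d N hN μ (q 0)) :
    IsFloquetSolution d h A nn Δ ((N : ℝ) * Δ) μ
      (fun t => concat (fun m s => blockExt hN μ (q s) m) (t / Δ)) := by
  have hP (m : ℤ) : blockExt hN μ (q 1) m = blockExt hN μ (q 0) (m + 1) := by
    rw [hq1, blockExt_Bop hN hμ]
  refine ⟨?_, fun t => ?_, fun t => ?_⟩
  · obtain ⟨n, hn⟩ := Function.ne_iff.1 hq0
    refine ⟨(n : ℕ) * Δ, ?_⟩
    beta_reduce
    rw [mul_div_cancel_right₀ _ hΔ.ne', concat]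
    simpa [blockExt_fin] using hn
  · have hΔc : (Δ : ℂ) ≠ 0 := by exact_mod_cast hΔ.ne'
    have hu : HasDerivAt (concat fun m s => blockExt hN μ (q s) m)
        (fun i => (Δ : ℂ) * ∑ j : Fin (h+1), ∑ i' : Fin d, ((A j t) i i' : ℂ) *
          concat (fun m s => blockExt hN μ (q s) m) ((t - (nn j : ℝ) * Δ) / Δ) i') (t / Δ) := by
      refine hasDerivAt_concat hP fun m h0 h1 => ?_
      refine (hasDerivAt_blockExt hN hper hμ
        (hq (t / Δ - m) ⟨by linarith, by linarith⟩) m).congr_deriv ?_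
      ext i
      congr 1
      refine Finset.sum_congr rfl fun j _ => Finset.sum_congr rfl fun i' _ => ?_
      have hs : (t - (nn j : ℝ) * Δ) / Δ = t / Δ - nn j := by field_simp
      rw [sub_add_cancel, div_mul_cancel₀ _ hΔ.ne', hs,
        concat_eq hP (m := m - nn j) (by push_cast; linarith) (by push_cast; linarith)]
      rw [Int.cast_sub, Int.cast_natCast, sub_sub_sub_cancel_right]
    refine (hu.scomp t ((hasDerivAt_id t).div_const Δ)).congr_deriv ?_
    ext i
    simp only [Pi.smul_apply, Complex.real_smul]
    rw [Complex.ofReal_div, Complex.ofReal_one, ← mul_assoc, one_div_mul_cancel hΔc, one_mul]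
  · ext i
    have h1 : (t + N * Δ) / Δ = t / Δ + N := by field_simp
    simp only [h1, concat, Int.floor_add_natCast]
    have := blockExt_add_mul hN hμ (q (t / Δ - ⌊t / Δ⌋)) ⌊t / Δ⌋ 1 i
    rw [one_mul, zpow_one] at this
    rw [← this, Int.cast_add, Int.cast_natCast, add_sub_add_right_eq_sub]

/-- **Lemma 2.1.** `μ ≠ 0` is a Floquet multiplier of the periodic delay system
`x'(t) = Σ_j A_j(t) x(t - τ_j)` (with `τ_j = n_j Δ`, `T = N Δ`) if and only if the
two-point boundary value problem `q'(s) = A(s,μ) q(s)` on `[0,1]`, `q(1) = B(μ) q(0)`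
has a solution with `q(0) ≠ 0`. -/
theorem floquet_multiplier_iff_bvp
    (d h N : ℕ) (hd : 0 < d) (hN : 0 < N) (Δ : ℝ) (hΔ : 0 < Δ)
    (A : Fin (h+1) → ℝ → Matrix (Fin d) (Fin d) ℝ)
    (hA : ∀ j, Continuous (A j))
    (hper : ∀ j t, A j (t + (N : ℝ) * Δ) = A j t)
    (nn : Fin (h+1) → ℕ) (hn0 : nn 0 = 0)
    (hmono : ∀ i j : Fin (h+1), 1 ≤ (i : ℕ) → i < j → nn i < nn j)
    (μ : ℂ) (hμ : μ ≠ 0) :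
    (∃ x : ℝ → Fin d → ℂ, IsFloquetSolution d h A nn Δ ((N : ℝ) * Δ) μ x) ↔
    (∃ q : ℝ → Fin N → Fin d → ℂ, q 0 ≠ 0 ∧
      (∀ s ∈ Set.Icc (0:ℝ) 1, HasDerivAt q (Aop d h N hN Δ A nn s μ (q s)) s) ∧
      q 1 = Bop d N hN μ (q 0)) := by
  constructor
  · rintro ⟨x, hx⟩
    refine ⟨fun s n => x ((s + (n : ℕ)) * Δ), fun h0 => ?_,
      fun s _ => hasDerivAt_blocks hN hμ hx s, ?_⟩
    · obtain ⟨t, ht⟩ := hx.1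
      have hz := eq_zero_of_linear_ode (continuous_AopLin hN hA nn μ)
        (fun s => hasDerivAt_blocks hN hμ hx s) h0 (t / Δ)
      apply ht
      simpa [div_mul_cancel₀ _ hΔ.ne'] using congrFun hz ⟨0, hN⟩
    · ext n i
      unfold Bop
      split_ifs with hn
      · simp [add_comm (1 : ℝ)]
      · have hn' : ((n : ℕ) : ℝ) + 1 = N := by
          have := n.2
          exact_mod_cast (by omega : (n : ℕ) + 1 = N)
        have := congrFun (hx.2.2 0) i
        simpa [add_comm (1 : ℝ), hn'] using this
  · rintro ⟨q, hq0, hq, hq1⟩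
    exact ⟨_, isFloquetSolution_concat hN hΔ hper hμ hq0 hq hq1⟩
end
end

section
/- Fix j ∈ {1, …, k} and K_0 ∈ ℝ^k. Suppose μ : ℝ^k → ℂ \ {0} and v : ℝ^k → (ℂ^d)^N are differentiable at K_0 with v(K) ≠ 0, and for every K in a neighborhood of K_0 every differentiable solution q_K of q'(s) = A(s, μ(K); K) q(s) on [0,1] with q_K(0) = v(K) satisfies q_K(1) = B(μ(K)) v(K) (i.e., N(μ(K); K) v(K) = 0). Write μ_0 = μ(K_0), v_0 = v(K_0). Let u ∈ (ℂ^d)^N be a left eigenvector at (μ_0, K_0): u*(q(1) − B(μ_0)w) = 0 for every w ∈ (ℂ^d)^N and every differentiable solution q of q'(s) = A(s, μ_0; K_0)q(s) on [0,1] with q(0) = w. Let q, q_{K_j}, q_μ : [0,1] → (ℂ^d)^N be differentiable with q'(s) = A(s, μ_0; K_0) q(s), q(0) = v_0; q_{K_j}'(s) = (∂A/∂K_j)(s, μ_0; K_0) q(s) + A(s, μ_0; K_0) q_{K_j}(s), q_{K_j}(0) = 0; and q_μ'(s) = (∂A/∂μ)(s, μ_0; K_0) q(s) + A(s, μ_0;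 K_0) q_μ(s), q_μ(0) = 0. If u* q_μ(1) − u* v_{0,N} ≠ 0, where v_{0,N} = (0, …, 0, (v_0)_1), then the partial derivative of μ with respect to K_j at K_0 equals −(u* q_{K_j}(1)) / (u* q_μ(1) − u* v_{0,N}). (Proposition 5.1: derivative of a simple Floquet multiplier with respect to a parameter via variational equations.) -/
open scoped BigOperators

noncomputable section

/-- The parametrized block linear map `A(s,μ;K)` on `(ℂ^d)^N`:
`(A(s,μ;K)q)_n = Δ Σ_j A_j((s+n-1)Δ; K) μ^{a_{n-n_j}} q_{b_{n-n_j}}`. Applying it with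
the matrices `∂A_j/∂K_j` in place of `A_j` gives `(∂A/∂K_j)(s,μ;K)`. -/
def AopP (d h N k : ℕ) (hN : 0 < N) (Δ : ℝ)
    (A : Fin (h+1) → ℝ → (Fin k → ℝ) → Matrix (Fin d) (Fin d) ℝ) (nn : Fin (h+1) → ℕ)
    (s : ℝ) (μ : ℂ) (K : Fin k → ℝ) (q : Fin N → Fin d → ℂ) : Fin N → Fin d → ℂ :=
  fun n i => (Δ : ℂ) * ∑ j : Fin (h+1),
    μ ^ aExp N (((n : ℕ) : ℤ) + 1 - (nn j : ℤ)) *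
      ∑ i' : Fin d, ((A j ((s + ((n : ℕ) : ℝ)) * Δ) K) i i' : ℂ) *
        q (bIdx N hN (((n : ℕ) : ℤ) + 1 - (nn j : ℤ))) i'

/-- The parametrized block linear map `(∂A/∂μ)(s,μ;K)` on `(ℂ^d)^N`. -/
def AopPDmu (d h N k : ℕ) (hN : 0 < N) (Δ : ℝ)
    (A : Fin (h+1) → ℝ → (Fin k → ℝ) → Matrix (Fin d) (Fin d) ℝ) (nn : Fin (h+1) → ℕ)
    (s : ℝ) (μ : ℂ) (K : Fin k → ℝ) (q : Fin N → Fin d → ℂ) : Fin N → Fin d → ℂ :=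
  fun n i => (Δ : ℂ) * ∑ j : Fin (h+1),
    (aExp N (((n : ℕ) : ℤ) + 1 - (nn j : ℤ)) : ℂ) *
      μ ^ (aExp N (((n : ℕ) : ℤ) + 1 - (nn j : ℤ)) - 1) *
      ∑ i' : Fin d, ((A j ((s + ((n : ℕ) : ℝ)) * Δ) K) i i' : ℂ) *
        q (bIdx N hN (((n : ℕ) : ℤ) + 1 - (nn j : ℤ))) i'

section LinearODE

open Set Filter Topology

variable {E : Type*} [NormedAddCommGroup E] [NormedSpace ℝ E]

/-- The radial retraction onto the closed ball of radius `R` is `2`-Lipschitz. -/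
theorem lipschitzWith_radial {R : ℝ} (hR : 0 < R) :
    LipschitzWith 2 (fun x : E => (R / max R ‖x‖) • x) := by
  refine LipschitzWith.of_dist_le_mul fun x y => ?_
  rw [dist_eq_norm, dist_eq_norm]
  set a := max R ‖x‖
  set b := max R ‖y‖
  have ha : 0 < a := hR.trans_le (le_max_left _ _)
  have hb : 0 < b := hR.trans_le (le_max_left _ _)
  have hsub : |b - a| ≤ ‖x - y‖ := by
    have h1 := abs_max_sub_max_le_max R ‖y‖ R ‖x‖
    have h2 := abs_norm_sub_norm_le y x
    rw [norm_sub_rev] at h2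
    simp only [sub_self, abs_zero] at h1
    exact h1.trans (max_le (norm_nonneg _) h2)
  have hsplit : (R / a) • x - (R / b) • y = (R / a) • (x - y) + (R / a * ((b - a) / b)) • y := by
    rw [smul_sub, sub_add, ← sub_smul]
    congr 2
    field_simp
    ring
  have hRa : R / a ≤ 1 := (div_le_one ha).2 (le_max_left _ _)
  have hRa0 : 0 ≤ R / a := by positivity
  have hyb : ‖y‖ / b ≤ 1 := (div_le_one hb).2 (le_max_right _ _)
  calc ‖(R / a) • x - (R / b) • y‖
      ≤ R / a * ‖x - y‖ + R / a * (|b - a| * (‖y‖ / b)) := by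
        rw [hsplit]
        refine (norm_add_le _ _).trans (le_of_eq ?_)
        rw [norm_smul, norm_smul, norm_mul, Real.norm_of_nonneg hRa0, norm_div (b - a),
          Real.norm_of_nonneg hb.le, Real.norm_eq_abs]
        ring
    _ ≤ 1 * ‖x - y‖ + 1 * (‖x - y‖ * 1) := by gcongr
    _ = ((2 : NNReal) : ℝ) * ‖x - y‖ := by push_cast; ring

/-- The radial retraction does not increase the norm. -/
theorem norm_radial_le {R : ℝ} (hR : 0 < R) (x : E) : ‖(R / max R ‖x‖) • x‖ ≤ ‖x‖ := by
  have hm : 0 < max R ‖x‖ := hR.trans_le (le_max_left _ _)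
  rw [norm_smul, Real.norm_of_nonneg (by positivity)]
  exact mul_le_of_le_one_left (norm_nonneg _) ((div_le_one hm).2 (le_max_left _ _))

/-- The radial retraction takes values in the closed ball of radius `R`. -/
theorem norm_radial_le_radius {R : ℝ} (hR : 0 < R) (x : E) : ‖(R / max R ‖x‖) • x‖ ≤ R := by
  have hm : 0 < max R ‖x‖ := hR.trans_le (le_max_left _ _)
  rw [norm_smul, Real.norm_of_nonneg (by positivity), div_mul_eq_mul_div, div_le_iff₀ hm]
  exact mul_le_mul_of_nonneg_left (le_max_right _ _) hR.le

/-- Linear initial value problems with continuous coefficients on `[0, 1]` have a solution,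
differentiable (from both sides) at every point of `[0, 1]`. -/
theorem exists_linearODE_solution [CompleteSpace E] (L : C(Icc (0 : ℝ) 1, E →L[ℝ] E)) (x₀ : E) :
    ∃ x : ℝ → E, x 0 = x₀ ∧ ∀ s : Icc (0 : ℝ) 1, HasDerivAt x (L s (x s)) s := by
  let Λ : ℝ → E →L[ℝ] E := IccExtend zero_le_one L
  have hΛc : Continuous Λ := L.continuous.Icc_extend'
  have hΛ : ∀ t, ‖Λ t‖ ≤ ‖L‖ := fun t => L.norm_coe_le_norm _
  obtain ⟨R, hR⟩ : ∃ R : ℝ, R = ‖x₀‖ * Real.exp (‖L‖ * 2) + 1 := ⟨_, rfl⟩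
  have hR0 : 0 < R := by rw [hR]; positivity
  let ρ : E → E := fun x => (R / max R ‖x‖) • x
  let M : NNReal := ‖L‖₊
  let B : NNReal := M * ⟨R, hR0.le⟩
  have hPL : IsPicardLindelof (fun t x => Λ t (ρ x)) (tmin := -1) (tmax := 2)
      ⟨0, by norm_num, by norm_num⟩ x₀ (B * 2) 0 B (M * 2) := by
    refine ⟨fun t _ => ?_, fun x _ => ?_, fun t _ x _ => ?_, ?_⟩
    · refine LipschitzWith.lipschitzOnWith ?_
      exact ((Λ t).lipschitz.weaken (hΛ t)).comp (lipschitzWith_radial hR0)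
    · exact (hΛc.clm_apply continuous_const).continuousOn
    · exact (Λ t).le_of_opNorm_le_of_le (hΛ t) (norm_radial_le_radius hR0 x)
    · norm_num
  obtain ⟨x, hx0, hx⟩ := hPL.exists_eq_forall_mem_Icc_hasDerivWithinAt₀
  have hx0 : x 0 = x₀ := hx0
  have hder : ∀ t ∈ Ioo (-1 : ℝ) 2, HasDerivAt x (Λ t (ρ (x t))) t := fun t ht =>
    (hx t (Ioo_subset_Icc_self ht)).hasDerivAt (Icc_mem_nhds ht.1 ht.2)
  have hbound := norm_le_gronwallBound_of_norm_deriv_right_le (f := x)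
    (f' := fun t => Λ t (ρ (x t))) (δ := ‖x₀‖) (K := ‖L‖) (ε := 0) (a := 0) (b := 1)
    (fun t ht => (hder t ⟨by linarith [ht.1], by linarith [ht.2]⟩).continuousAt.continuousWithinAt)
    (fun t ht => (hder t ⟨by linarith [ht.1], by linarith [ht.2]⟩).hasDerivWithinAt)
    (by rw [hx0])
    (fun t _ => by
      rw [add_zero]
      exact (Λ t).le_of_opNorm_le_of_le (hΛ t) (norm_radial_le hR0 _))
  refine ⟨x, hx0, fun s => ?_⟩
  have hs := s.2
  have hxs : ‖x s‖ ≤ R := by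
    refine (hbound s hs).trans ?_
    rw [gronwallBound_ε0, sub_zero, hR]
    have : ‖L‖ * (s : ℝ) ≤ ‖L‖ * 2 :=
      mul_le_mul_of_nonneg_left (by linarith [hs.2]) (norm_nonneg L)
    have := mul_le_mul_of_nonneg_left (Real.exp_le_exp.2 this) (norm_nonneg x₀)
    linarith
  have hρ : ρ (x s) = x s := by
    simp only [ρ]
    rw [max_eq_left hxs, div_self hR0.ne', one_smul]
  have hΛs : Λ s = L s := IccExtend_val _ _ s
  have := hder s ⟨by linarith [hs.1], by linarith [hs.2]⟩
  rwa [hρ, hΛs] at this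

/-- **Differentiation of linear flows with respect to a parameter**: the derivative of the time-one
value solves the variational equation. -/
theorem hasDerivAt_linearODE_param {L : ℝ → C(Icc (0 : ℝ) 1, E →L[ℝ] E)}
    {L' : C(Icc (0 : ℝ) 1, E →L[ℝ] E)} {z₀ : ℝ} (hL : HasDerivAt L L' z₀)
    {Q : ℝ → ℝ → E} {r : ℝ → E}
    (hQ : ∀ z, ∀ s : Icc (0 : ℝ) 1, HasDerivAt (Q z) (L z s (Q z s)) s)
    (hr : ∀ s : Icc (0 : ℝ) 1, HasDerivAt r (L' s (Q z₀ s) + L z₀ s (r s)) s)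
    (hQ0 : HasDerivAt (fun z => Q z 0) (r 0) z₀) :
    HasDerivAt (fun z => Q z 1) (r 1) z₀ := by
  have hqc : ContinuousOn (Q z₀) (Icc 0 1) :=
    fun s hs => (hQ z₀ ⟨s, hs⟩).continuousAt.continuousWithinAt
  have hrc : ContinuousOn r (Icc 0 1) :=
    fun s hs => (hr ⟨s, hs⟩).continuousAt.continuousWithinAt
  obtain ⟨C₁, hC₁⟩ := isCompact_Icc.exists_bound_of_continuousOn hqc
  obtain ⟨C₂, hC₂⟩ := isCompact_Icc.exists_bound_of_continuousOn hrc
  set K : ℝ := ‖L z₀‖ + 1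
  have hK : 0 < K := by positivity
  set G : ℝ := gronwallBound 1 K (C₁ + C₂) 1
  have hgron : ∀ η : ℝ, gronwallBound η K (η * (C₁ + C₂)) 1 = G * η := fun η => by
    simp only [G, gronwallBound_of_K_ne_0 hK.ne']
    ring
  have hLc := HasDerivAt.continuousAt (𝕜 := ℝ) (F := C(Icc (0 : ℝ) 1, E →L[ℝ] E)) (f := L) hL
  replace hL := (hasDerivAt_iff_isLittleO (𝕜 := ℝ)
    (F := C(Icc (0 : ℝ) 1, E →L[ℝ] E)) (f := L)).1 hL
  rw [hasDerivAt_iff_isLittleO] at hQ0 ⊢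
  refine (Asymptotics.isLittleO_iff.2 fun c hc => ?_)
  obtain ⟨ε, hε, hεc⟩ : ∃ ε : ℝ, 0 < ε ∧ G * ε ≤ c := by
    refine ⟨c / (|G| + 1), by positivity, ?_⟩
    rw [mul_div_assoc', div_le_iff₀ (by positivity), mul_comm]
    exact mul_le_mul_of_nonneg_left ((le_abs_self G).trans (by linarith)) hc.le
  filter_upwards [hL.bound hε, hQ0.bound hε,
    hLc.eventually (Metric.ball_mem_nhds _ hε),
    hLc.eventually (Metric.ball_mem_nhds _ one_pos)] with z hz1 hz2 hz3 hz4
  rw [dist_eq_norm] at hz3 hz4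
  have hLz : ‖L z‖ ≤ K := by
    have := norm_le_norm_add_norm_sub' (L z) (L z₀)
    linarith
  set δ := z - z₀
  have hC₁0 : 0 ≤ C₁ := (norm_nonneg _).trans (hC₁ 0 (by simp))
  have hC₂0 : 0 ≤ C₂ := (norm_nonneg _).trans (hC₂ 0 (by simp))
  have hD : ∀ s : Icc (0 : ℝ) 1, HasDerivAt (fun t => Q z t - Q z₀ t - δ • r t)
      (L z s (Q z s) - L z₀ s (Q z₀ s) - δ • (L' s (Q z₀ s) + L z₀ s (r s))) s :=
    fun s => ((hQ z s).fun_sub (hQ z₀ s)).fun_sub ((hr s).const_smul δ)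
  have hmain := norm_le_gronwallBound_of_norm_deriv_right_le
    (f := fun t => Q z t - Q z₀ t - δ • r t)
    (f' := fun t => L z (projIcc 0 1 zero_le_one t) (Q z t) -
      L z₀ (projIcc 0 1 zero_le_one t) (Q z₀ t) -
      δ • (L' (projIcc 0 1 zero_le_one t) (Q z₀ t) + L z₀ (projIcc 0 1 zero_le_one t) (r t)))
    (δ := ε * ‖δ‖) (K := K) (ε := (ε * ‖δ‖) * (C₁ + C₂)) (a := 0) (b := 1)
    (fun s hs => (hD ⟨s, hs⟩).continuousAt.continuousWithinAt)
    (fun s hs => by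
      have hs' := Ico_subset_Icc_self hs
      simpa only [projIcc_of_mem zero_le_one hs'] using (hD ⟨s, hs'⟩).hasDerivWithinAt)
    hz2
    (fun s hs => by
      have hs' := Ico_subset_Icc_self hs
      rw [projIcc_of_mem zero_le_one hs']
      set σ : Icc (0 : ℝ) 1 := ⟨s, hs'⟩
      have hid : L z σ (Q z s) - L z₀ σ (Q z₀ s) - δ • (L' σ (Q z₀ s) + L z₀ σ (r s)) =
          L z σ (Q z s - Q z₀ s - δ • r s) +
            ((L z - L z₀ - δ • L') σ (Q z₀ s) + δ • (L z - L z₀) σ (r s)) := by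
        simp only [ContinuousMap.sub_apply, ContinuousMap.smul_apply,
          sub_apply, smul_apply, map_sub, map_smul,
          smul_add, smul_sub]
        abel
      rw [hid]
      refine (norm_add_le _ _).trans (add_le_add ?_ ((norm_add_le _ _).trans ?_))
      · exact ContinuousLinearMap.le_of_opNorm_le _
          (((L z).norm_coe_le_norm σ).trans hLz) _
      · have h1 := ContinuousLinearMap.le_of_opNorm_le_of_le _
          (((L z - L z₀ - δ • L').norm_coe_le_norm σ).trans hz1) (hC₁ s hs')
        have h2 := ContinuousLinearMap.le_of_opNorm_le_of_le _
          (((L z - L z₀).norm_coe_le_norm σ).trans hz3.le) (hC₂ s hs')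
        rw [norm_smul]
        have h3 := mul_le_mul_of_nonneg_left h2 (norm_nonneg δ)
        linarith)
    1 (by simp)
  rw [sub_zero, hgron] at hmain
  refine hmain.trans ?_
  rw [← mul_assoc]
  exact mul_le_mul_of_nonneg_right hεc (norm_nonneg _)

/-- A family of curves with jointly continuous partial derivative is differentiable with respect
to the parameter, uniformly in time. -/
theorem hasDerivAt_continuousMap_of_partial {I : Type*} [TopologicalSpace I] [CompactSpace I]
    {g g' : C(ℝ × I, E)} (h : ∀ z s, HasDerivAt (fun y => g (y, s)) (g' (z, s)) z) (z₀ : ℝ) :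
    HasDerivAt (fun z => g.curry z) (g'.curry z₀) z₀ := by
  refine hasDerivAt_iff_isLittleO.2 ?_
  refine Asymptotics.isLittleO_iff.2 fun c hc => ?_
  obtain ⟨η, hη, hball⟩ := Metric.eventually_nhds_iff_ball.1
    (g'.curry.continuous.continuousAt.eventually (Metric.ball_mem_nhds (g'.curry z₀) hc))
  filter_upwards [Metric.ball_mem_nhds z₀ hη] with z hz
  rw [ContinuousMap.norm_le _ (by positivity)]
  intro s
  have := (convex_ball z₀ η).norm_image_sub_le_of_norm_hasDerivWithin_le
    (f := fun y => g (y, s) - y • g' (z₀, s)) (f' := fun y => g' (y, s) - g' (z₀, s)) (C := c)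
    (fun y _ => by
      simpa using ((h y s).fun_sub ((hasDerivAt_id y).smul_const (g' (z₀, s)))).hasDerivWithinAt)
    (fun y hy => by
      have h1 := hball y hy
      rw [dist_eq_norm] at h1
      exact ((g'.curry y - g'.curry z₀).norm_coe_le_norm s).trans h1.le)
    (Metric.mem_ball_self hη) hz
  refine le_trans (le_of_eq ?_) this
  simp only [ContinuousMap.sub_apply, ContinuousMap.smul_apply, ContinuousMap.curry_apply,
    sub_smul]
  congr 1
  abel

end LinearODE

section BlockOperators

open Set

variable {N d : ℕ} {J : Type*} [Fintype J]

/-- The elementary block operator sending `q` to the vector with `c * q b i'` in block `n`,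
coordinate `i`, as a continuous linear function of the coefficient `c`. -/
def blockEntry (n : Fin N) (i : Fin d) (b : Fin N) (i' : Fin d) :
    ℂ →L[ℝ] (Fin N → Fin d → ℂ) →L[ℝ] (Fin N → Fin d → ℂ) :=
  (ContinuousLinearMap.compL ℝ (Fin N → Fin d → ℂ) ℂ (Fin N → Fin d → ℂ)
    ((ContinuousLinearMap.single ℝ (fun _ : Fin N => Fin d → ℂ) n).comp
      (ContinuousLinearMap.single ℝ (fun _ : Fin d => ℂ) i))).comp
    (((ContinuousLinearMap.compL ℝ (Fin N → Fin d → ℂ) ℂ ℂ).flip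
      ((ContinuousLinearMap.proj (R := ℝ) (φ := fun _ : Fin d => ℂ) i').comp
        (ContinuousLinearMap.proj (R := ℝ) (φ := fun _ : Fin N => Fin d → ℂ) b))).comp
      (ContinuousLinearMap.mul ℝ ℂ))

theorem blockEntry_apply (n : Fin N) (i : Fin d) (b : Fin N) (i' : Fin d) (c : ℂ)
    (q : Fin N → Fin d → ℂ) :
    blockEntry n i b i' c q = Pi.single n (Pi.single i (c * q b i')) := rfl

/-- The path of block operators with given continuous coefficients. -/
def blockPath (b : Fin N → J → Fin N) (c : Fin N → Fin d → J → Fin d → C(Icc (0 : ℝ) 1, ℂ)) :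
    C(Icc (0 : ℝ) 1, (Fin N → Fin d → ℂ) →L[ℝ] (Fin N → Fin d → ℂ)) :=
  ∑ n, ∑ i, ∑ j, ∑ i',
    (blockEntry n i (b n j) i').compLeftContinuous ℝ (Icc (0 : ℝ) 1) (c n i j i')

theorem blockPath_apply (b : Fin N → J → Fin N)
    (c : Fin N → Fin d → J → Fin d → C(Icc (0 : ℝ) 1, ℂ)) (s : Icc (0 : ℝ) 1)
    (q : Fin N → Fin d → ℂ) (n : Fin N) (i : Fin d) :
    blockPath b c s q n i = ∑ j, ∑ i', c n i j i' s * q (b n j) i' := by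
  have hcomp : ∀ (T : ℂ →L[ℝ] (Fin N → Fin d → ℂ) →L[ℝ] (Fin N → Fin d → ℂ))
      (f : C(Icc (0 : ℝ) 1, ℂ)), T.compLeftContinuous ℝ (Icc (0 : ℝ) 1) f s = T (f s) :=
    fun _ _ => rfl
  simp only [blockPath, ContinuousMap.coe_sum, Finset.sum_apply, sum_apply, hcomp, blockEntry_apply]
  rw [Finset.sum_eq_single n (fun m _ hm => by simp [Pi.single_eq_of_ne hm.symm]) (by simp),
    Finset.sum_eq_single i (fun m _ hm => by simp [Pi.single_eq_of_ne hm.symm]) (by simp)]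
  simp

theorem hasDerivAt_compLeftContinuous {I F G : Type*} [TopologicalSpace I] [CompactSpace I]
    [NormedAddCommGroup F] [NormedSpace ℝ F] [NormedAddCommGroup G] [NormedSpace ℝ G]
    (T : F →L[ℝ] G) {c : ℝ → C(I, F)} {c' : C(I, F)} {z₀ : ℝ} (h : HasDerivAt c c' z₀) :
    HasDerivAt (fun z => T.compLeftContinuous ℝ I (c z)) (T.compLeftContinuous ℝ I c') z₀ :=
  HasFDerivAt.comp_hasDerivAt (F := C(I, F)) (E := C(I, G)) z₀
    (T.compLeftContinuous ℝ I).hasFDerivAt h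

theorem hasDerivAt_blockPath (b : Fin N → J → Fin N)
    {c : ℝ → Fin N → Fin d → J → Fin d → C(Icc (0 : ℝ) 1, ℂ)}
    {c' : Fin N → Fin d → J → Fin d → C(Icc (0 : ℝ) 1, ℂ)} {z₀ : ℝ}
    (h : ∀ n i j i', HasDerivAt (fun z => c z n i j i') (c' n i j i') z₀) :
    HasDerivAt (fun z => blockPath b (c z)) (blockPath b c') z₀ := by
  unfold blockPath
  iterate 4
    refine HasDerivAt.fun_sum (𝕜 := ℝ)
      (F := C(Icc (0 : ℝ) 1, (Fin N → Fin d → ℂ) →L[ℝ] (Fin N → Fin d → ℂ))) fun _ _ => ?_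
  exact hasDerivAt_compLeftContinuous _ (h _ _ _ _)

theorem hasDerivAt_Bop (hN : 0 < N) {μ : ℝ → ℂ} {μ' : ℂ} {v : ℝ → Fin N → Fin d → ℂ}
    {v' : Fin N → Fin d → ℂ} {z₀ : ℝ} (hμ : HasDerivAt μ μ' z₀) (hv : HasDerivAt v v' z₀) :
    HasDerivAt (fun z => Bop d N hN (μ z) (v z))
      (Pi.single ⟨N - 1, by omega⟩ (μ' • v z₀ ⟨0, hN⟩) + Bop d N hN (μ z₀) v') z₀ := by
  refine hasDerivAt_pi.2 fun n => hasDerivAt_pi.2 fun i => ?_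
  have hvc : ∀ m, HasDerivAt (fun z => v z m i) (v' m i) z₀ := fun m =>
    hasDerivAt_pi.1 (hasDerivAt_pi.1 hv m) i
  by_cases hn : (n : ℕ) + 1 < N
  · have hne : n ≠ ⟨N - 1, by omega⟩ := fun h => by
      have := congrArg Fin.val h
      simp only at this
      omega
    simpa [Bop, hn, Pi.single_eq_of_ne hne] using hvc ⟨n + 1, hn⟩
  · have heq : n = ⟨N - 1, by omega⟩ := Fin.ext (by have := n.2; simp only; omega)
    rw [← heq]
    simpa [Bop, hn] using hμ.fun_mul (hvc ⟨0, hN⟩)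

end BlockOperators

section FloquetParameter

open Set

variable {d h N k : ℕ}

/-- The coefficient `s ↦ A_l((s + n)Δ; K)_{i i'}` along the line `K = update K₀ jp z`, as a
continuous function of `(z, s)`. -/
def lineCoeff (Δ : ℝ) (A : Fin (h+1) → ℝ → (Fin k → ℝ) → Matrix (Fin d) (Fin d) ℝ)
    (hA : ∀ l, Continuous fun pr : ℝ × (Fin k → ℝ) => A l pr.1 pr.2) (jp : Fin k)
    (K₀ : Fin k → ℝ) (n : Fin N) (i : Fin d) (l : Fin (h+1)) (i' : Fin d) :
    C(ℝ × Icc (0 : ℝ) 1, ℂ) where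
  toFun p := ((A l (((p.2 : ℝ) + ((n : ℕ) : ℝ)) * Δ) (Function.update K₀ jp p.1) i i' : ℝ) : ℂ)
  continuous_toFun := by
    have h1 : Continuous fun p : ℝ × Icc (0 : ℝ) 1 =>
        ((((p.2 : ℝ) + ((n : ℕ) : ℝ)) * Δ, Function.update K₀ jp p.1) : ℝ × (Fin k → ℝ)) :=
      (by fun_prop : Continuous fun p : ℝ × Icc (0 : ℝ) 1 =>
        ((p.2 : ℝ) + ((n : ℕ) : ℝ)) * Δ).prodMk (continuous_const.update jp continuous_fst)
    exact Complex.continuous_ofReal.comp (((hA l).comp h1).matrix_elem i i')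

theorem hasDerivAt_lineCoeff {Δ : ℝ}
    {A AK : Fin (h+1) → ℝ → (Fin k → ℝ) → Matrix (Fin d) (Fin d) ℝ}
    (hA : ∀ l, Continuous fun pr : ℝ × (Fin k → ℝ) => A l pr.1 pr.2)
    (hAKc : ∀ l, Continuous fun pr : ℝ × (Fin k → ℝ) => AK l pr.1 pr.2) {jp : Fin k}
    (hAK : ∀ l t K i i',
      HasDerivAt (fun z : ℝ => A l t (Function.update K jp z) i i') (AK l t K i i') (K jp))
    (K₀ : Fin k → ℝ) (n : Fin N) (i : Fin d) (l : Fin (h+1)) (i' : Fin d) (z₀ : ℝ) :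
    HasDerivAt (fun z => (lineCoeff Δ A hA jp K₀ n i l i').curry z)
      ((lineCoeff Δ AK hAKc jp K₀ n i l i').curry z₀) z₀ := by
  refine hasDerivAt_continuousMap_of_partial (fun z s => ?_) z₀
  have := (hAK l (((s : ℝ) + ((n : ℕ) : ℝ)) * Δ) (Function.update K₀ jp z) i i').ofReal_comp
  simp only [Function.update_idem, Function.update_self] at this
  exact this

theorem blockPath_eq_AopP (hN : 0 < N) (Δ : ℝ)
    (A : Fin (h+1) → ℝ → (Fin k → ℝ) → Matrix (Fin d) (Fin d) ℝ)
    (hA : ∀ l, Continuous fun pr : ℝ × (Fin k → ℝ) => A l pr.1 pr.2)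
    (nn : Fin (h+1) → ℕ) (jp : Fin k) (K₀ : Fin k → ℝ) (μ : ℂ) (z : ℝ) (s : Icc (0 : ℝ) 1)
    (q : Fin N → Fin d → ℂ) :
    blockPath (fun n l => bIdx N hN (((n : ℕ) : ℤ) + 1 - (nn l : ℤ)))
      (fun n i l i' => ((Δ : ℂ) * μ ^ aExp N (((n : ℕ) : ℤ) + 1 - (nn l : ℤ))) •
        (lineCoeff Δ A hA jp K₀ n i l i').curry z) s q =
      AopP d h N k hN Δ A nn s μ (Function.update K₀ jp z) q := by
  ext n i
  rw [blockPath_apply]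
  simp only [AopP, Finset.mul_sum, ContinuousMap.smul_apply, ContinuousMap.curry_apply, lineCoeff,
    ContinuousMap.coe_mk, smul_eq_mul, mul_assoc]

end FloquetParameter

/-- **Proposition 5.1.** Let `(μ(K), v(K))` be a branch of eigenpairs of the parametrized
characteristic matrix `N(μ;K)` near `K₀`, differentiable at `K₀`, let `u` be a left
eigenvector at `(μ₀, K₀) = (μ(K₀), K₀)`, and let `q`, `q_{K_j}`, `q_μ` solve the
initial value problems (5.2). If `u* q_μ(1) - u* v_N ≠ 0` then
`∂μ/∂K_j(K₀) = -(u* q_{K_j}(1)) / (u* q_μ(1) - u* v_N)`. -/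
theorem floquet_multiplier_param_deriv
    (d h N k : ℕ) (hd : 0 < d) (hN : 0 < N) (hk : 0 < k) (Δ : ℝ) (hΔ : 0 < Δ)
    (A AK : Fin (h+1) → ℝ → (Fin k → ℝ) → Matrix (Fin d) (Fin d) ℝ)
    (nn : Fin (h+1) → ℕ) (hn0 : nn 0 = 0)
    (hmono : ∀ i j : Fin (h+1), 1 ≤ (i : ℕ) → i < j → nn i < nn j)
    (hper : ∀ l t K, A l (t + (N : ℝ) * Δ) K = A l t K)
    (hAcont : ∀ l, Continuous fun pr : ℝ × (Fin k → ℝ) => A l pr.1 pr.2)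
    (hAKcont : ∀ l, Continuous fun pr : ℝ × (Fin k → ℝ) => AK l pr.1 pr.2)
    (jp : Fin k) (K0 : Fin k → ℝ)
    (hAK : ∀ l t K i i',
      HasDerivAt (fun z : ℝ => A l t (Function.update K jp z) i i') (AK l t K i i') (K jp))
    (μ : (Fin k → ℝ) → ℂ) (v : (Fin k → ℝ) → Fin N → Fin d → ℂ)
    (hμdiff : DifferentiableAt ℝ μ K0) (hvdiff : DifferentiableAt ℝ v K0)
    (hμne : ∀ K, μ K ≠ 0)
    (heig : ∀ᶠ K in nhds K0, v K ≠ 0 ∧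
      ∀ Q : ℝ → Fin N → Fin d → ℂ, Q 0 = v K →
        (∀ s ∈ Set.Icc (0:ℝ) 1,
          HasDerivAt Q (AopP d h N k hN Δ A nn s (μ K) K (Q s)) s) →
        Q 1 = Bop d N hN (μ K) (v K))
    (u : Fin N → Fin d → ℂ)
    (hu : ∀ w : Fin N → Fin d → ℂ, ∀ q : ℝ → Fin N → Fin d → ℂ, q 0 = w →
      (∀ s ∈ Set.Icc (0:ℝ) 1,
        HasDerivAt q (AopP d h N k hN Δ A nn s (μ K0) K0 (q s)) s) →
      (∑ n : Fin N, ∑ i : Fin d,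
        (starRingEnd ℂ) (u n i) * (q 1 n i - Bop d N hN (μ K0) w n i)) = 0)
    (q qK qmu : ℝ → Fin N → Fin d → ℂ)
    (hq0 : q 0 = v K0)
    (hqode : ∀ s ∈ Set.Icc (0:ℝ) 1,
      HasDerivAt q (AopP d h N k hN Δ A nn s (μ K0) K0 (q s)) s)
    (hqK0 : qK 0 = 0)
    (hqKode : ∀ s ∈ Set.Icc (0:ℝ) 1, HasDerivAt qK (fun n i =>
      AopP d h N k hN Δ AK nn s (μ K0) K0 (q s) n i +
      AopP d h N k hN Δ A nn s (μ K0) K0 (qK s) n i) s)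
    (hqmu0 : qmu 0 = 0)
    (hqmuode : ∀ s ∈ Set.Icc (0:ℝ) 1, HasDerivAt qmu (fun n i =>
      AopPDmu d h N k hN Δ A nn s (μ K0) K0 (q s) n i +
      AopP d h N k hN Δ A nn s (μ K0) K0 (qmu s) n i) s)
    (hden : (∑ n : Fin N, ∑ i : Fin d, (starRingEnd ℂ) (u n i) * qmu 1 n i) -
      (∑ i : Fin d, (starRingEnd ℂ) (u ⟨N - 1, by omega⟩ i) * v K0 ⟨0, hN⟩ i) ≠ 0) :
    fderiv ℝ μ K0 (Pi.single jp 1) =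
      -(∑ n : Fin N, ∑ i : Fin d, (starRingEnd ℂ) (u n i) * qK 1 n i) /
        ((∑ n : Fin N, ∑ i : Fin d, (starRingEnd ℂ) (u n i) * qmu 1 n i) -
         (∑ i : Fin d, (starRingEnd ℂ) (u ⟨N - 1, by omega⟩ i) * v K0 ⟨0, hN⟩ i)) := by
  set z₀ := K0 jp
  have hKz₀ : Function.update K0 jp z₀ = K0 := Function.update_eq_self jp K0
  have hline : HasDerivAt (Function.update K0 jp) (Pi.single jp 1) z₀ := hasDerivAt_update K0 jp z₀
  have hcomp : ∀ {F : Type} [NormedAddCommGroup F] [NormedSpace ℝ F] {f : (Fin k → ℝ) → F},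
      DifferentiableAt ℝ f K0 → HasDerivAt (fun z => f (Function.update K0 jp z))
        (fderiv ℝ f K0 (Pi.single jp 1)) z₀ := fun {F} _ _ {f} hf =>
    HasFDerivAt.comp_hasDerivAt_of_eq z₀ hf.hasFDerivAt hline hKz₀.symm
  have hμ := hcomp hμdiff
  have hv := hcomp hvdiff
  set μ' := fderiv ℝ μ K0 (Pi.single jp 1)
  set v' := fderiv ℝ v K0 (Pi.single jp 1)
  -- the coefficient path and its derivative along the parameter line
  let b : Fin N → Fin (h+1) → Fin N := fun n l => bIdx N hN (((n : ℕ) : ℤ) + 1 - (nn l : ℤ))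
  let a : Fin N → Fin (h+1) → ℤ := fun n l => aExp N (((n : ℕ) : ℤ) + 1 - (nn l : ℤ))
  let L : ℝ → C(Set.Icc (0 : ℝ) 1, (Fin N → Fin d → ℂ) →L[ℝ] (Fin N → Fin d → ℂ)) := fun z =>
    blockPath b fun n i l i' => ((Δ : ℂ) * μ (Function.update K0 jp z) ^ a n l) •
      (lineCoeff Δ A hAcont jp K0 n i l i').curry z
  let L' : C(Set.Icc (0 : ℝ) 1, (Fin N → Fin d → ℂ) →L[ℝ] (Fin N → Fin d → ℂ)) :=
    blockPath b fun n i l i' =>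
      ((Δ : ℂ) * μ K0 ^ a n l) • (lineCoeff Δ AK hAKcont jp K0 n i l i').curry z₀ +
        ((Δ : ℂ) * (a n l * μ K0 ^ (a n l - 1) * μ')) •
          (lineCoeff Δ A hAcont jp K0 n i l i').curry z₀
  have hL : HasDerivAt L L' z₀ := by
    refine hasDerivAt_blockPath b fun n i l i' => ?_
    have h1 : HasDerivAt (fun z => (Δ : ℂ) * μ (Function.update K0 jp z) ^ a n l)
        ((Δ : ℂ) * (a n l * μ K0 ^ (a n l - 1) * μ')) z₀ := by
      have := (hasDerivAt_zpow (a n l) (μ (Function.update K0 jp z₀)) (Or.inl (hμne _))).comp z₀ hμ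
      rw [hKz₀] at this
      exact this.const_mul _
    have := HasDerivAt.fun_smul (F := C(Set.Icc (0 : ℝ) 1, ℂ)) h1
      (hasDerivAt_lineCoeff (Δ := Δ) hAcont hAKcont hAK K0 n i l i' z₀)
    simpa only [hKz₀] using this
  have hLapp : ∀ z s x, L z s x = AopP d h N k hN Δ A nn s (μ (Function.update K0 jp z))
      (Function.update K0 jp z) x := fun z s x =>
    blockPath_eq_AopP hN Δ A hAcont nn jp K0 _ z s x
  have hLapp₀ : ∀ s x, L z₀ s x = AopP d h N k hN Δ A nn s (μ K0) K0 x := fun s x => by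
    rw [hLapp, hKz₀]
  have hL'app : ∀ s x n i, L' s x n i = AopP d h N k hN Δ AK nn s (μ K0) K0 x n i +
      μ' * AopPDmu d h N k hN Δ A nn s (μ K0) K0 x n i := fun s x n i => by
    simp only [L', blockPath_apply, AopP, AopPDmu, Finset.mul_sum, ← Finset.sum_add_distrib]
    refine Finset.sum_congr rfl fun l _ => Finset.sum_congr rfl fun i' _ => ?_
    simp only [ContinuousMap.add_apply, ContinuousMap.smul_apply, ContinuousMap.curry_apply,
      lineCoeff, ContinuousMap.coe_mk, smul_eq_mul, hKz₀, a, b]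
    ring
  choose Q hQ0 hQ using fun z => exists_linearODE_solution (L z) (v (Function.update K0 jp z))
  have hq : Set.EqOn (Q z₀) q (Set.Icc 0 1) := by
    obtain ⟨M, hM⟩ : ∃ M : NNReal, M = ‖L z₀‖₊ := ⟨_, rfl⟩
    refine ODE_solution_unique (v := fun t => L z₀ (Set.projIcc 0 1 zero_le_one t)) (K := M)
      (fun t => ?_)
      (fun s hs => (hQ z₀ ⟨s, hs⟩).continuousAt.continuousWithinAt) (fun s hs => ?_)
      (fun s hs => (hqode s hs).continuousAt.continuousWithinAt) (fun s hs => ?_) ?_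
    · rw [hM]
      exact (L z₀ _).lipschitz.weaken ((L z₀).norm_coe_le_norm _)
    · have hs' := Set.Ico_subset_Icc_self hs
      simpa only [Set.projIcc_of_mem zero_le_one hs'] using (hQ z₀ ⟨s, hs'⟩).hasDerivWithinAt
    · have hs' := Set.Ico_subset_Icc_self hs
      simpa only [Set.projIcc_of_mem zero_le_one hs', hLapp₀] using
        (hqode s hs').hasDerivWithinAt
    · rw [hQ0, hKz₀, hq0]
  obtain ⟨y, hy0, hy⟩ := exists_linearODE_solution (L z₀) v'
  have hr : ∀ s : Set.Icc (0 : ℝ) 1, HasDerivAt (fun t => qK t + μ' • qmu t + y t)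
      (L' s (Q z₀ s) + L z₀ s (qK s + μ' • qmu s + y s)) s := fun s => by
    refine (((hqKode s s.2).fun_add ((hqmuode s s.2).fun_const_smul μ')).fun_add
      (hy s)).congr_deriv ?_
    have hsmul : L z₀ s (μ' • qmu s) = μ' • L z₀ s (qmu s) := by
      ext n i
      simp only [hLapp₀, AopP, Pi.smul_apply, smul_eq_mul, Finset.mul_sum]
      refine Finset.sum_congr rfl fun l _ => Finset.sum_congr rfl fun i' _ => ?_
      ring
    rw [hq s.2, map_add, map_add, hsmul]
    ext n i
    simp only [Pi.add_apply, Pi.smul_apply, smul_eq_mul, hL'app, ← hLapp₀]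
    ring
  have hQ1 : HasDerivAt (fun z => Q z 1) (qK 1 + μ' • qmu 1 + y 1) z₀ :=
    hasDerivAt_linearODE_param hL hQ hr (by simpa [hQ0, hqK0, hqmu0, hy0] using hv)
  have hB := hasDerivAt_Bop hN hμ hv
  have heigz : ∀ᶠ z in nhds z₀, Q z 1 =
      Bop d N hN (μ (Function.update K0 jp z)) (v (Function.update K0 jp z)) := by
    have hc := hline.continuousAt.tendsto
    rw [hKz₀] at hc
    filter_upwards [hc.eventually heig] with z hz
    refine hz.2 (Q z) (hQ0 z) fun s hs => ?_
    simpa only [hLapp] using hQ z ⟨s, hs⟩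
  have hderiv := hQ1.unique (hB.congr_of_eventuallyEq heigz)
  rw [hKz₀] at hderiv
  have hy1 := hu v' y hy0 fun s hs => by simpa only [hLapp₀] using hy ⟨s, hs⟩
  have hpair : ∑ n : Fin N, ∑ i : Fin d, (starRingEnd ℂ) (u n i) *
        (qK 1 n i + μ' * qmu 1 n i + (y 1 n i - Bop d N hN (μ K0) v' n i)) =
      μ' * ∑ i : Fin d, (starRingEnd ℂ) (u ⟨N - 1, by omega⟩ i) * v K0 ⟨0, hN⟩ i := by
    have hcoord : ∀ n i, qK 1 n i + μ' * qmu 1 n i + (y 1 n i - Bop d N hN (μ K0) v' n i) =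
        (Pi.single ⟨N - 1, by omega⟩ (μ' • v K0 ⟨0, hN⟩) : Fin N → Fin d → ℂ) n i := fun n i => by
      have := congrFun (congrFun hderiv n) i
      simp only [Pi.add_apply, Pi.smul_apply, smul_eq_mul] at this
      linear_combination this
    simp only [hcoord]
    rw [Finset.sum_eq_single ⟨N - 1, by omega⟩
      (fun m _ hm => by simp [Pi.single_eq_of_ne hm]) (by simp), Finset.mul_sum]
    refine Finset.sum_congr rfl fun i _ => ?_
    rw [Pi.single_eq_same, Pi.smul_apply, smul_eq_mul]
    ring
  rw [eq_div_iff hden]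
  simp only [mul_add, Finset.sum_add_distrib, hy1, mul_left_comm _ μ', ← Finset.mul_sum] at hpair
  linear_combination hpair
end
end
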